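/- Let ν be an automorphism of the symmetric group S_6 satisfying ν((1 2)) = (1 2)(3 4)(5 6) and ν((1 2 3 4 5 6)) = (1 2 3)(4 5). Then there is no automorphism φ of B'_6 such that μ'∘φ = ν∘μ'. -/

import Mathlib

/-- Relators of the Artin presentation of the braid group on `n` strings:
generators `σ_0, …, σ_{n-2}` (0-based), with `σ_i σ_j = σ_j σ_i` for `|i-j| > 1`
and `σ_i σ_j σ_i = σ_j σ_i σ_j` for `|i-j| = 1`. -/
def braidRels (n : ℕ) : Set (FreeGroup (Fin (n - 1))) :=
  {r | (∃ i j : Fin (n - 1), (i : ℕ) + 2 ≤ (j : ℕ) ∧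
          r = FreeGroup.of i * FreeGroup.of j * (FreeGroup.of i)⁻¹ * (FreeGroup.of j)⁻¹) ∨
       (∃ i j : Fin (n - 1), (j : ℕ) = (i : ℕ) + 1 ∧
          r = FreeGroup.of i * FreeGroup.of j * FreeGroup.of i *
              (FreeGroup.of j * FreeGroup.of i * FreeGroup.of j)⁻¹)}

/-- The braid group `B_n`, presented by Artin generators and relations. -/
abbrev BraidGroup (n : ℕ) := PresentedGroup (braidRels n)

/-- The Artin generator `σ_{i+1}` (1-based), i.e. `σ i` for `i : Fin (n-1)` (0-based). -/
def σ {n : ℕ} (i : Fin (n - 1)) : BraidGroup n := PresentedGroup.of i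

section CoxeterTypeA

variable {G : Type*} [Group G]

/-- The descending product `s k * s (k - 1) * ⋯ * s (k + 1 - m)` of `m` factors. -/
def descProd (s : ℕ → G) (k : ℕ) : ℕ → G
  | 0 => 1
  | m + 1 => descProd s k m * s (k - m)

variable {s : ℕ → G} {n : ℕ}

lemma descProd_mul_of_lt
    (hcomm : ∀ i j, i + 2 ≤ j → j < n → s i * s j = s j * s i)
    {k m i : ℕ} (hk : k < n) (hm : m ≤ k) (hi : i + m < k) :
    descProd s k m * s i = s i * descProd s k m := by
  induction m with
  | zero => simp [descProd]
  | succ m ih =>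
    have h := hcomm i (k - m) (by omega) (by omega)
    rw [descProd, mul_assoc, ← h, ← mul_assoc, ih (by omega) (by omega), mul_assoc]

lemma descProd_mul_of_gt
    (hcomm : ∀ i j, i + 2 ≤ j → j < n → s i * s j = s j * s i)
    (hbraid : ∀ i, i + 1 < n → s i * s (i + 1) * s i = s (i + 1) * s i * s (i + 1))
    {k m i : ℕ} (hk : k < n) (hm : m ≤ k + 1) (hi : i < k) (him : k < i + m) :
    descProd s k m * s (i + 1) = s i * descProd s k m := by
  induction m with
  | zero => omega
  | succ m ih =>
    rcases Nat.lt_or_ge k (i + m) with h | h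
    · have h' := hcomm (k - m) (i + 1) (by omega) (by omega)
      rw [descProd, mul_assoc, h', ← mul_assoc, ih (by omega) h, mul_assoc]
    · obtain rfl : k = i + m := by omega
      obtain ⟨m, rfl⟩ : ∃ l, m = l + 1 := ⟨m - 1, by omega⟩
      have e1 : i + (m + 1) - (m + 1) = i := by omega
      have e2 : i + (m + 1) - m = i + 1 := by omega
      have hb := hbraid i (by omega)
      have hlow := descProd_mul_of_lt hcomm hk (m := m) (i := i) (by omega) (by omega)
      simp only [descProd, e1, e2]
      calc descProd s (i + (m + 1)) m * s (i + 1) * s i * s (i + 1)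
          = descProd s (i + (m + 1)) m * (s (i + 1) * s i * s (i + 1)) := by
            simp only [mul_assoc]
        _ = (descProd s (i + (m + 1)) m * s i) * s (i + 1) * s i := by
            rw [← hb]; simp only [mul_assoc]
        _ = _ := by rw [hlow]; simp only [mul_assoc]

lemma exists_eq_mul_descProd
    (hsq : ∀ i, i < n → s i * s i = 1)
    (hcomm : ∀ i j, i + 2 ≤ j → j < n → s i * s j = s j * s i)
    (hbraid : ∀ i, i + 1 < n → s i * s (i + 1) * s i = s (i + 1) * s i * s (i + 1))
    {k : ℕ} (hk : k < n) {g : G} (hg : g ∈ Subgroup.closure (s '' Set.Iio (k + 1))) :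
    ∃ u ∈ Subgroup.closure (s '' Set.Iio k), ∃ m ≤ k + 1, g = u * descProd s k m := by
  have step : ∀ g i, i < k + 1 →
      (∃ u ∈ Subgroup.closure (s '' Set.Iio k), ∃ m ≤ k + 1, g = u * descProd s k m) →
      ∃ u ∈ Subgroup.closure (s '' Set.Iio k), ∃ m ≤ k + 1,
        g * s i = u * descProd s k m := by
    rintro _ i hi ⟨u, hu, m, hm, rfl⟩
    have hmem : ∀ l, l < k → s l ∈ Subgroup.closure (s '' Set.Iio k) := fun l hl =>
      Subgroup.subset_closure ⟨l, hl, rfl⟩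
    rcases lt_trichotomy (i + m) k with h | h | h
    · refine ⟨u * s i, mul_mem hu (hmem i (by omega)), m, hm, ?_⟩
      rw [mul_assoc, descProd_mul_of_lt hcomm hk (by omega) h, mul_assoc]
    · refine ⟨u, hu, m + 1, by omega, ?_⟩
      rw [mul_assoc, descProd, show k - m = i by omega]
    · rcases Nat.lt_or_ge (k + 1) (i + m) with h' | h'
      · obtain ⟨i, rfl⟩ : ∃ l, i = l + 1 := ⟨i - 1, by omega⟩
        refine ⟨u * s i, mul_mem hu (hmem i (by omega)), m, hm, ?_⟩
        rw [mul_assoc, descProd_mul_of_gt hcomm hbraid hk hm (by omega) (by omega), mul_assoc]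
      · obtain ⟨m, rfl⟩ : ∃ l, m = l + 1 := ⟨m - 1, by omega⟩
        refine ⟨u, hu, m, by omega, ?_⟩
        rw [descProd, show k - m = i by omega, mul_assoc, mul_assoc, hsq i (by omega), mul_one]
  induction hg using Subgroup.closure_induction_right with
  | one => exact ⟨1, one_mem _, 0, by omega, by simp [descProd]⟩
  | mul_right x _ y hy ih =>
    obtain ⟨i, hi, rfl⟩ := hy
    exact step _ i hi ih
  | mul_inv_cancel x _ y hy ih =>
    obtain ⟨i, hi, rfl⟩ := hy
    rw [inv_eq_of_mul_eq_one_left (hsq i (lt_of_lt_of_le hi hk))]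
    exact step _ i hi ih

/-- Elements satisfying the Coxeter relations of type `A` and acting as adjacent transpositions
generate a subgroup that acts faithfully. -/
lemma eq_one_of_mem_closure_of_perm_eq_one {α : Type*} (π : G →* Equiv.Perm α) (p : ℕ → α)
    (hp : Set.InjOn p (Set.Iic n))
    (hsq : ∀ i, i < n → s i * s i = 1)
    (hcomm : ∀ i j, i + 2 ≤ j → j < n → s i * s j = s j * s i)
    (hbraid : ∀ i, i + 1 < n → s i * s (i + 1) * s i = s (i + 1) * s i * s (i + 1))
    (hmove : ∀ i, i < n → π (s i) (p i) = p (i + 1))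
    (hfix : ∀ i j, i + 1 < j → j ≤ n → π (s i) (p j) = p j)
    {k : ℕ} (hk : k ≤ n) {g : G} (hg : g ∈ Subgroup.closure (s '' Set.Iio k)) (h : π g = 1) :
    g = 1 := by
  induction k generalizing g with
  | zero => simpa using hg
  | succ k ih =>
    obtain ⟨u, hu, m, hm, rfl⟩ := exists_eq_mul_descProd hsq hcomm hbraid hk hg
    have hfixu : π u (p (k + 1)) = p (k + 1) := by
      have hle : Subgroup.closure (s '' Set.Iio k) ≤
          (MulAction.stabilizer (Equiv.Perm α) (p (k + 1))).comap π := by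
        rw [Subgroup.closure_le]
        rintro _ ⟨i, hi, rfl⟩
        exact hfix i (k + 1) (Nat.succ_lt_succ hi) hk
      exact hle hu
    have hdesc : ∀ m ≤ k + 1, π (descProd s k m) (p (k + 1 - m)) = p (k + 1) := by
      intro m hm
      induction m with
      | zero => simp [descProd]
      | succ m ih =>
        have h' := hmove (k - m) (by omega)
        rw [descProd, map_mul, Equiv.Perm.mul_apply, show k + 1 - (m + 1) = k - m by omega, h',
          show k - m + 1 = k + 1 - m by omega, ih (by omega)]
    have hpt : p (k + 1) = p (k + 1 - m) := by
      have h' := DFunLike.congr_fun h (p (k + 1 - m))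
      rwa [map_mul, Equiv.Perm.mul_apply, hdesc m hm, hfixu] at h'
    have hm0 : k + 1 = k + 1 - m := hp (Set.mem_Iic.2 hk) (Set.mem_Iic.2 (by omega)) hpt
    obtain rfl : m = 0 := by omega
    simp only [descProd, mul_one] at h ⊢
    exact ih (by omega) hu h

end CoxeterTypeA

section BraidRelations

lemma σ_comm {n : ℕ} {i j : Fin (n - 1)} (h : (i : ℕ) + 2 ≤ j) :
    Commute (σ i : BraidGroup n) (σ j) := by
  have h' : PresentedGroup.mk (braidRels n) _ = 1 :=
    PresentedGroup.one_of_mem (rels := braidRels n) (Or.inl ⟨i, j, h, rfl⟩)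
  simp only [map_mul, map_inv] at h'
  rw [mul_inv_eq_one, mul_inv_eq_iff_eq_mul] at h'
  exact h'

lemma σ_braid {n : ℕ} {i j : Fin (n - 1)} (h : (j : ℕ) = i + 1) :
    (σ i * σ j * σ i : BraidGroup n) = σ j * σ i * σ j := by
  have h' : PresentedGroup.mk (braidRels n) _ = 1 :=
    PresentedGroup.one_of_mem (rels := braidRels n) (Or.inr ⟨i, j, h, rfl⟩)
  simp only [map_mul, map_inv] at h'
  exact mul_inv_eq_one.1 h'

lemma closure_range_σ (n : ℕ) :
    Subgroup.closure (Set.range (σ : Fin (n - 1) → BraidGroup n)) = ⊤ :=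
  PresentedGroup.closure_range_of _

/-- The homomorphism out of the braid group determined by the images of the generators. -/
def braidLift {n : ℕ} {G : Type*} [Group G] (f : Fin (n - 1) → G)
    (hcomm : ∀ i j : Fin (n - 1), (i : ℕ) + 2 ≤ j → f i * f j = f j * f i)
    (hbraid : ∀ i j : Fin (n - 1), (j : ℕ) = i + 1 → f i * f j * f i = f j * f i * f j) :
    BraidGroup n →* G :=
  PresentedGroup.toGroup (f := f) (by
    rintro _ (⟨i, j, h, rfl⟩ | ⟨i, j, h, rfl⟩)
    · simp [hcomm i j h]
    · rw [map_mul, map_inv, mul_inv_eq_one]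
      simpa using hbraid i j h)

@[simp] lemma braidLift_σ {n : ℕ} {G : Type*} [Group G] (f : Fin (n - 1) → G) (hcomm) (hbraid)
    (i : Fin (n - 1)) : braidLift f hcomm hbraid (σ i) = f i :=
  PresentedGroup.toGroup.of _

variable {G : Type*} [Group G] {a b c : G}

lemma semiconj_of_braid (h : a * b * a = b * a * b) : SemiconjBy (a * b) a b := by
  rw [SemiconjBy, h, mul_assoc]

/-- Crossing two neighbouring pairs of strands exchanges the generators twisting each pair. -/
lemma semiconj_pair_crossing (hab : a * b * a = b * a * b) (hbc : b * c * b = c * b * c)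
    (hac : Commute a c) : SemiconjBy (b * a * c * b) a c := by
  have hac : a * c = c * a := hac
  calc b * a * c * b * a = b * (a * c) * b * a := by simp only [mul_assoc]
    _ = b * c * (a * b * a) := by rw [hac]; simp only [mul_assoc]
    _ = b * c * b * (a * b) := by rw [hab]; simp only [mul_assoc]
    _ = c * b * (c * a) * b := by rw [hbc]; simp only [mul_assoc]
    _ = c * (b * a * c * b) := by rw [← hac]; simp only [mul_assoc]

lemma sq_eq_of_semiconj {u p q r : G} (hp : Commute u p) (hq : SemiconjBy u q r)
    (h : p ^ 2 = q ^ 2) : p ^ 2 = r ^ 2 := by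
  have h1 : u * p ^ 2 = p ^ 2 * u := hp.pow_right 2
  have h2 : u * q ^ 2 = r ^ 2 * u := hq.pow_right 2
  rw [← h, h1] at h2
  exact mul_right_cancel h2

lemma SemiconjBy.conj_eq {g x y : G} (h : SemiconjBy g x y) : g * x * g⁻¹ = y := by
  rw [h.eq, mul_inv_cancel_right]

end BraidRelations

section SixStrands

/-- The pure braid `σ₁² σ₃⁻²`. -/
def twistDiff : BraidGroup 6 := σ 0 ^ 2 * (σ 2 ^ 2)⁻¹

/-- Modulo `σ₁² σ₃⁻²` all squares of generators agree. -/
lemma sq_eq_sq_of_twistDiff {Q : Type*} [Group Q] (f : BraidGroup 6 →* Q)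
    (hf : f twistDiff = 1) (i : Fin (6 - 1)) : f (σ 0) ^ 2 = f (σ i) ^ 2 := by
  have hc : ∀ {i j : Fin (6 - 1)}, (i : ℕ) + 2 ≤ j → Commute (f (σ i)) (f (σ j)) :=
    fun h => (σ_comm h).map f
  have hb : ∀ {i j : Fin (6 - 1)}, (j : ℕ) = i + 1 →
      SemiconjBy (f (σ i) * f (σ j)) (f (σ i)) (f (σ j)) :=
    fun h => semiconj_of_braid (by simpa using congrArg f (σ_braid h))
  have h2 : f (σ 0) ^ 2 = f (σ 2) ^ 2 := by
    rw [twistDiff, map_mul, map_inv, mul_inv_eq_one] at hf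
    simpa using hf
  have h3 : f (σ 0) ^ 2 = f (σ 3) ^ 2 :=
    sq_eq_of_semiconj (((hc (by decide)).mul_right (hc (by decide))).symm) (hb (by decide)) h2
  have h4 : f (σ 0) ^ 2 = f (σ 4) ^ 2 :=
    sq_eq_of_semiconj (((hc (by decide)).mul_right (hc (by decide))).symm) (hb (by decide)) h3
  have h1 : f (σ 3) ^ 2 = f (σ 1) ^ 2 :=
    sq_eq_of_semiconj ((hc (by decide)).mul_left (hc (by decide))) (hb (i := 0) (by decide))
      h3.symm
  fin_cases i
  exacts [rfl, h3.trans h1, h2, h3, h4]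

/-- A braid with trivial permutation dies in every quotient in which the squares of the generators
die. -/
lemma map_eq_one_of_perm_eq_one (μ : BraidGroup 6 →* Equiv.Perm (Fin 6))
    (hμ : ∀ i : Fin (6 - 1), μ (σ i) = Equiv.swap i.castSucc i.succ)
    {Q : Type*} [Group Q] (f : BraidGroup 6 →* Q) (hf : ∀ i, f (σ i) ^ 2 = 1)
    {g : BraidGroup 6} (hg : μ g = 1) : f g = 1 := by
  let F := f.prod μ
  let s : ℕ → Q × Equiv.Perm (Fin 6) := fun i => F (σ (Fin.ofNat 5 i))
  have hmem : F g ∈ Subgroup.closure (s '' Set.Iio 5) := by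
    have htop : Subgroup.closure (Set.range (σ : Fin (6 - 1) → BraidGroup 6)) ≤
        (Subgroup.closure (s '' Set.Iio 5)).comap F := by
      rw [Subgroup.closure_le]
      rintro _ ⟨i, rfl⟩
      refine Subgroup.subset_closure ⟨i, i.isLt, ?_⟩
      exact congrArg (fun j => F (σ j)) (Fin.ofNat_val_eq_self i)
    rw [closure_range_σ] at htop
    exact htop (Subgroup.mem_top g)
  have hval : ∀ i < 5, ((Fin.ofNat 5 i : Fin 5) : ℕ) = i := fun i hi => Nat.mod_eq_of_lt hi
  have key := eq_one_of_mem_closure_of_perm_eq_one (n := 5) (s := s)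
    (MonoidHom.snd Q (Equiv.Perm (Fin 6))) (fun i => Fin.ofNat 6 i) ?_ ?_ ?_ ?_ ?_ ?_ le_rfl
    hmem hg
  · exact congrArg Prod.fst key
  · intro i hi j hj h
    have h' := congrArg Fin.val h
    simp only [Set.mem_Iic] at hi hj
    simpa [Nat.mod_eq_of_lt (show i < 6 by omega), Nat.mod_eq_of_lt (show j < 6 by omega)] using h'
  · intro i _
    ext1
    · simpa [s, F, pow_two] using hf (Fin.ofNat 5 i)
    · simp [s, F, hμ]
  · intro i j hij hj
    rw [← map_mul, ← map_mul,
      (σ_comm (n := 6) (by rw [hval i (by omega), hval j hj]; exact hij)).eq]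
  · intro i hi
    simp only [s, ← map_mul]
    exact congrArg F (σ_braid (n := 6) (by rw [hval i (by omega), hval (i + 1) hi]))
  · intro i hi
    change μ (σ _) _ = _
    rw [hμ]
    interval_cases i <;> decide
  · intro i j hij hj
    change μ (σ _) _ = _
    rw [hμ]
    have hi : i < 4 := by omega
    interval_cases i <;> interval_cases j <;> decide

/-- The total exponent of a braid. -/
def braidExponent : BraidGroup 6 →* Multiplicative ℤ :=
  braidLift (fun _ => Multiplicative.ofAdd 1) (fun _ _ _ => rfl) (fun _ _ _ => rfl)

lemma commutator_le_ker_braidExponent : commutator (BraidGroup 6) ≤ braidExponent.ker :=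
  Abelianization.commutator_subset_ker _

/-- The braids of exponent zero with trivial permutation form the normal closure of
`σ₁² σ₃⁻²`. -/
lemma mem_normalClosure_twistDiff (μ : BraidGroup 6 →* Equiv.Perm (Fin 6))
    (hμ : ∀ i : Fin (6 - 1), μ (σ i) = Equiv.swap i.castSucc i.succ)
    {g : BraidGroup 6} (hg : g ∈ commutator (BraidGroup 6)) (hgμ : μ g = 1) :
    g ∈ Subgroup.normalClosure {twistDiff} := by
  let N : Subgroup (BraidGroup 6) := Subgroup.normalClosure {twistDiff}
  let f := QuotientGroup.mk' N
  have hx : f twistDiff = 1 :=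
    (QuotientGroup.eq_one_iff _).2 (Subgroup.subset_normalClosure rfl)
  have hsq := sq_eq_sq_of_twistDiff f hx
  have hcen : f (σ 0) ^ 2 ∈ Subgroup.center (BraidGroup 6 ⧸ N) := by
    have htop : Subgroup.closure (Set.range (σ : Fin (6 - 1) → BraidGroup 6)) ≤
        (Subgroup.centralizer {f (σ 0) ^ 2}).comap f := by
      rw [Subgroup.closure_le]
      rintro _ ⟨i, rfl⟩
      rw [SetLike.mem_coe, Subgroup.mem_comap, Subgroup.mem_centralizer_singleton_iff, hsq i]
      exact ((Commute.refl _).pow_right 2).eq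
    rw [closure_range_σ] at htop
    rw [Subgroup.mem_center_iff]
    intro y
    obtain ⟨y, rfl⟩ := QuotientGroup.mk'_surjective N y
    exact Subgroup.mem_centralizer_singleton_iff.1 (htop (Subgroup.mem_top y))
  have : (Subgroup.zpowers (f (σ 0) ^ 2)).Normal :=
    ⟨fun x hx y => by
      rwa [Subgroup.mem_center_iff.1 (Subgroup.zpowers_le.2 hcen hx) y, mul_inv_cancel_right]⟩
  have hg1 : (QuotientGroup.mk' (Subgroup.zpowers (f (σ 0) ^ 2))).comp f g = 1 := by
    refine map_eq_one_of_perm_eq_one μ hμ _ (fun i => ?_) hgμ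
    refine (map_pow (QuotientGroup.mk' _) (f (σ i)) 2).symm.trans ?_
    refine (QuotientGroup.eq_one_iff _).2 ?_
    rw [← hsq i]
    exact Subgroup.mem_zpowers _
  obtain ⟨e, he⟩ := (QuotientGroup.eq_one_iff _).1 hg1
  have he' : g * ((σ 0 ^ 2) ^ e)⁻¹ ∈ N := by
    rw [← QuotientGroup.eq_one_iff]
    change f _ = 1
    rw [map_mul, map_inv, map_zpow, map_pow, mul_inv_eq_one]
    exact he.symm
  have hN : N ≤ braidExponent.ker := by
    refine Subgroup.normalClosure_le_normal ?_
    rintro _ rfl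
    simp [twistDiff, braidExponent, MonoidHom.mem_ker]
  have h0 := hN he'
  have hg0 : braidExponent g = 1 := commutator_le_ker_braidExponent hg
  rw [MonoidHom.mem_ker, map_mul, hg0, one_mul, map_inv, inv_eq_one, map_zpow, map_pow] at h0
  have : e = 0 := by
    have h1 := congrArg Multiplicative.toAdd h0
    simpa [braidExponent] using h1
  simpa [this] using he'

/-- Every braid is a product of a commutator-subgroup element and a power of `σ₁`. -/
lemma exists_mul_zpow_mem_commutator (b : BraidGroup 6) :
    ∃ e : ℤ, b * (σ 0 ^ e)⁻¹ ∈ commutator (BraidGroup 6) := by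
  have hstep : ∀ i j : Fin (6 - 1), (j : ℕ) = i + 1 →
      Abelianization.of (σ j : BraidGroup 6) = Abelianization.of (σ i) := by
    intro i j h
    have hb := congrArg Abelianization.of (σ_braid h)
    simp only [map_mul] at hb
    rw [mul_comm (Abelianization.of (σ j)) (Abelianization.of (σ i))] at hb
    exact (mul_left_cancel hb).symm
  have hall : ∀ i : Fin (6 - 1),
      Abelianization.of (σ i : BraidGroup 6) = Abelianization.of (σ 0) := by
    have h1 := hstep 0 1 rfl
    have h2 := (hstep 1 2 rfl).trans h1
    have h3 := (hstep 2 3 rfl).trans h2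
    have h4 := (hstep 3 4 rfl).trans h3
    intro i
    fin_cases i
    exacts [rfl, h1, h2, h3, h4]
  have htop : Subgroup.closure (Set.range (σ : Fin (6 - 1) → BraidGroup 6)) ≤
      (Subgroup.zpowers (Abelianization.of (σ 0 : BraidGroup 6))).comap Abelianization.of := by
    rw [Subgroup.closure_le]
    rintro _ ⟨i, rfl⟩
    rw [SetLike.mem_coe, Subgroup.mem_comap, hall i]
    exact Subgroup.mem_zpowers _
  rw [closure_range_σ] at htop
  obtain ⟨e, he⟩ := htop (Subgroup.mem_top b)
  refine ⟨e, ?_⟩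
  rw [← Abelianization.ker_of, MonoidHom.mem_ker, map_mul, map_inv, map_zpow, mul_inv_eq_one]
  exact he.symm

lemma mem_commutator_iff {b : BraidGroup 6} :
    b ∈ commutator (BraidGroup 6) ↔ braidExponent b = 1 := by
  refine ⟨fun h => commutator_le_ker_braidExponent h, fun h => ?_⟩
  obtain ⟨e, he⟩ := exists_mul_zpow_mem_commutator b
  have h0 : braidExponent _ = 1 := commutator_le_ker_braidExponent he
  rw [map_mul, h, one_mul, map_inv, inv_eq_one, map_zpow] at h0
  have : e = 0 := by
    have h1 := congrArg Multiplicative.toAdd h0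
    simpa [braidExponent] using h1
  simpa [this] using he

lemma commute_twistDiff : Commute (σ 0) twistDiff :=
  ((Commute.refl _).pow_right 2).mul_right (((σ_comm (by decide)).pow_right 2).inv_right)

/-- The group of permutations of six strands decorated by integers. -/
abbrev DecoratedPerm :=
  (Fin 6 → Multiplicative ℤ) ⋊[mulAutArrow (G := Equiv.Perm (Fin 6))] Equiv.Perm (Fin 6)

/-- The decorated transposition recording a crossing on both strands involved. -/
def decoratedSwap (i : Fin (6 - 1)) : DecoratedPerm :=
  ⟨fun k => if k = i.castSucc ∨ k = i.succ then Multiplicative.ofAdd 1 else 1,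
    Equiv.swap i.castSucc i.succ⟩

/-- Each braid is sent to its permutation together with, for every strand, the signed number of
crossings involving it. -/
def crossingHom : BraidGroup 6 →* DecoratedPerm :=
  braidLift decoratedSwap
    (fun i j h => SemidirectProduct.ext (by revert i j; decide) (by revert i j; decide))
    (fun i j h => SemidirectProduct.ext (by revert i j; decide) (by revert i j; decide))

lemma crossingHom_right (μ : BraidGroup 6 →* Equiv.Perm (Fin 6))
    (hμ : ∀ i : Fin (6 - 1), μ (σ i) = Equiv.swap i.castSucc i.succ) (b : BraidGroup 6) :
    (crossingHom b).right = μ b := by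
  have : SemidirectProduct.rightHom.comp crossingHom = μ := by
    refine PresentedGroup.ext fun i => ?_
    change (crossingHom (σ i)).right = μ (σ i)
    rw [hμ, crossingHom, braidLift_σ]
    rfl
  exact DFunLike.congr_fun this b

lemma crossingHom_twistDiff_ne_one : crossingHom twistDiff ≠ 1 := by
  intro h
  have h0 := congrArg (fun g : DecoratedPerm => (g.left 0).toAdd) h
  simp only [twistDiff, crossingHom, map_mul, map_inv, map_pow, braidLift_σ] at h0
  revert h0
  decide

lemma DecoratedPerm.conj_inl (g : DecoratedPerm) (w : Fin 6 → Multiplicative ℤ) :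
    g * SemidirectProduct.inl w * g⁻¹ =
      SemidirectProduct.inl (fun k => w (g.right⁻¹ k)) := by
  rw [mul_inv_eq_iff_eq_mul]
  ext k
  · simp [mulAutArrow_apply_apply, mul_comm]
    rfl
  · simp

/-- The images of the adjacent transpositions under the outer automorphism of `S₆`. -/
def outerSwap (i : Fin (6 - 1)) : Equiv.Perm (Fin 6) :=
  let c : Equiv.Perm (Fin 6) := Equiv.swap 0 2 * Equiv.swap 0 1 * Equiv.swap 3 4
  c ^ (i : ℕ) * (Equiv.swap 0 1 * Equiv.swap 2 3 * Equiv.swap 4 5) * (c ^ (i : ℕ))⁻¹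

lemma map_swap_eq_outerSwap (ν : MulAut (Equiv.Perm (Fin 6)))
    (hν1 : ν (Equiv.swap 0 1) = Equiv.swap 0 1 * Equiv.swap 2 3 * Equiv.swap 4 5)
    (hν2 : ν (finRotate 6) = Equiv.swap 0 2 * Equiv.swap 0 1 * Equiv.swap 3 4)
    (i : Fin (6 - 1)) : ν (Equiv.swap i.castSucc i.succ) = outerSwap i := by
  have h : ∀ i : Fin (6 - 1), (Equiv.swap i.castSucc i.succ : Equiv.Perm (Fin 6)) =
      finRotate 6 ^ (i : ℕ) * Equiv.swap 0 1 * (finRotate 6 ^ (i : ℕ))⁻¹ := by decide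
  rw [h, map_mul, map_mul, map_inv, map_pow, hν1, hν2, outerSwap]

set_option maxRecDepth 4000 in
/-- The only integer vector having the symmetries of `σ₁² σ₃⁻²`, twisted by the outer
automorphism of `S₆`, is zero. -/
lemma eq_one_of_outerSwap_symm (w : Fin 6 → Multiplicative ℤ)
    (h₁ : ∀ k, w ((outerSwap 0 * (outerSwap 2)⁻¹)⁻¹ k) = w k)
    (h₂ : ∀ k, w ((outerSwap 0 * (outerSwap 4)⁻¹)⁻¹ k) = w k)
    (h₃ : ∀ k, w ((outerSwap 1 * outerSwap 0 * outerSwap 2 * outerSwap 1)⁻¹ k) = (w k)⁻¹)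
    (h₄ : ∀ k, w k * w ((outerSwap 3 * outerSwap 2 * outerSwap 4 * outerSwap 3)⁻¹
        ((outerSwap 1 * outerSwap 0 * outerSwap 2 * outerSwap 1)⁻¹ k)) =
      w ((outerSwap 3 * outerSwap 2 * outerSwap 4 * outerSwap 3)⁻¹ k)) : w = 1 := by
  have e₁ : ∀ k, (outerSwap 0 * (outerSwap 2)⁻¹)⁻¹ k = ![3, 2, 1, 0, 4, 5] k := by decide
  have e₂ : ∀ k, (outerSwap 0 * (outerSwap 4)⁻¹)⁻¹ k = ![2, 3, 0, 1, 4, 5] k := by decide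
  have e₃ : ∀ k, (outerSwap 1 * outerSwap 0 * outerSwap 2 * outerSwap 1)⁻¹ k =
    ![0, 2, 1, 3, 5, 4] k := by decide
  have e₄ : ∀ k, (outerSwap 3 * outerSwap 2 * outerSwap 4 * outerSwap 3)⁻¹ k =
    ![1, 0, 2, 3, 5, 4] k := by decide
  simp only [e₁] at h₁
  simp only [e₂] at h₂
  simp only [e₃] at h₃
  simp only [e₃, e₄] at h₄
  have a : (w 3).toAdd = (w 0).toAdd := congrArg Multiplicative.toAdd (h₁ 0)
  have b : (w 2).toAdd = (w 1).toAdd := congrArg Multiplicative.toAdd (h₁ 1)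
  have c : (w 2).toAdd = (w 0).toAdd := congrArg Multiplicative.toAdd (h₂ 0)
  have d : (w 0).toAdd = -(w 0).toAdd := congrArg Multiplicative.toAdd (h₃ 0)
  have e : (w 5).toAdd = -(w 4).toAdd := congrArg Multiplicative.toAdd (h₃ 4)
  have f : (w 4).toAdd + (w 4).toAdd = (w 5).toAdd := congrArg Multiplicative.toAdd (h₄ 4)
  have hw : ∀ k, (w k).toAdd = 0 := by
    intro k
    fin_cases k <;> simp only [Fin.reduceFinMk, Fin.zero_eta, Fin.mk_one] <;> omega
  exact funext fun k => toAdd_eq_zero.1 (hw k)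

lemma SemiconjBy.sq_mul_inv_sq {G : Type*} [Group G] {g p q r s : G} (hp : SemiconjBy g p r)
    (hq : SemiconjBy g q s) : SemiconjBy g (p ^ 2 * (q ^ 2)⁻¹) (r ^ 2 * (s ^ 2)⁻¹) :=
  (hp.pow_right 2).mul_right (hq.pow_right 2).inv_right

set_option maxRecDepth 4000 in
lemma outerSwap_pow_four : ∀ i, outerSwap i ^ 4 = 1 := by decide

/-- A homomorphism on the commutator subgroup whose permutation part is the standard
one twisted by the outer automorphism of `S₆` kills `σ₁² σ₃⁻²`. -/
lemma map_twistDiff_eq_one (μ : BraidGroup 6 →* Equiv.Perm (Fin 6))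
    (hμ : ∀ i : Fin (6 - 1), μ (σ i) = Equiv.swap i.castSucc i.succ)
    (ν : MulAut (Equiv.Perm (Fin 6)))
    (hν : ∀ i : Fin (6 - 1), ν (Equiv.swap i.castSucc i.succ) = outerSwap i)
    (ψ : commutator (BraidGroup 6) →* DecoratedPerm) (hψ : ∀ g, (ψ g).right = ν (μ g))
    (X : commutator (BraidGroup 6)) (hX : (X : BraidGroup 6) = twistDiff) : ψ X = 1 := by
  have hexp : ∀ i, braidExponent (σ i) = Multiplicative.ofAdd 1 := fun i => braidLift_σ _ _ _ i
  have hνμ : ∀ i, ν (μ (σ i)) = outerSwap i := fun i => by rw [hμ, hν]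
  have hsq := outerSwap_pow_four
  have hc : ∀ {i j : Fin (6 - 1)}, (i : ℕ) + 2 ≤ j → Commute (σ i : BraidGroup 6) (σ j) := σ_comm
  have hcross : ∀ i j k : Fin (6 - 1), (j : ℕ) = i + 1 → (k : ℕ) = j + 1 →
      SemiconjBy (σ j * σ i * σ k * σ j : BraidGroup 6) (σ i) (σ k) ∧
      SemiconjBy (σ j * σ i * σ k * σ j : BraidGroup 6) (σ k) (σ i) := by
    intro i j k hij hjk
    have hik : Commute (σ i : BraidGroup 6) (σ k) := hc (by omega)
    refine ⟨semiconj_pair_crossing (σ_braid hij) (σ_braid hjk) hik, ?_⟩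
    have h := semiconj_pair_crossing (σ_braid hjk).symm (σ_braid hij).symm hik.symm
    rwa [mul_assoc (σ j) (σ k) (σ i), ← hik.eq, ← mul_assoc] at h
  let a₁ : commutator (BraidGroup 6) := ⟨σ 0 * (σ 2)⁻¹, by simp [mem_commutator_iff, hexp]⟩
  let a₂ : commutator (BraidGroup 6) := ⟨σ 0 * (σ 4)⁻¹, by simp [mem_commutator_iff, hexp]⟩
  let g : commutator (BraidGroup 6) := ⟨σ 1 * σ 0 * σ 2 * σ 1 * (σ 4 ^ 4)⁻¹, by
    rw [mem_commutator_iff]; simp only [map_mul, map_inv, map_pow, hexp]; rfl⟩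
  let h : commutator (BraidGroup 6) := ⟨σ 3 * σ 2 * σ 4 * σ 3 * (σ 0 ^ 4)⁻¹, by
    rw [mem_commutator_iff]; simp only [map_mul, map_inv, map_pow, hexp]; rfl⟩
  have h02 : Commute (σ 0 : BraidGroup 6) (σ 2) := hc (by decide)
  have h04 : Commute (σ 0 : BraidGroup 6) (σ 4) := hc (by decide)
  have h24 : Commute (σ 2 : BraidGroup 6) (σ 4) := hc (by decide)
  have h14 : Commute (σ 1 : BraidGroup 6) (σ 4) := hc (by decide)
  have h03 : Commute (σ 0 : BraidGroup 6) (σ 3) := hc (by decide)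
  have hg0 : SemiconjBy (g : BraidGroup 6) (σ 0) (σ 2) :=
    (hcross 0 1 2 rfl rfl).1.mul_left (h04.symm.pow_left 4).inv_left
  have hg2 : SemiconjBy (g : BraidGroup 6) (σ 2) (σ 0) :=
    (hcross 0 1 2 rfl rfl).2.mul_left (h24.symm.pow_left 4).inv_left
  have hg4 : SemiconjBy (g : BraidGroup 6) (σ 4) (σ 4) :=
    (((h14.mul_left h04).mul_left h24).mul_left h14).mul_left
      ((Commute.refl _).pow_left 4).inv_left
  have hh2 : SemiconjBy (h : BraidGroup 6) (σ 2) (σ 4) :=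
    (hcross 2 3 4 rfl rfl).1.mul_left (h02.pow_left 4).inv_left
  have hh0 : SemiconjBy (h : BraidGroup 6) (σ 0) (σ 0) :=
    (((h03.symm.mul_left h02.symm).mul_left h04.symm).mul_left h03.symm).mul_left
      ((Commute.refl _).pow_left 4).inv_left
  have r₁ : a₁ * X * a₁⁻¹ = X := by
    ext
    push_cast
    rw [hX]
    exact (SemiconjBy.sq_mul_inv_sq ((Commute.refl _).mul_left h02.symm.inv_left)
      (h02.mul_left (Commute.refl _).inv_left)).conj_eq
  have r₂ : a₂ * X * a₂⁻¹ = X := by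
    ext
    push_cast
    rw [hX]
    exact (SemiconjBy.sq_mul_inv_sq ((Commute.refl _).mul_left h04.symm.inv_left)
      (h02.mul_left h24.symm.inv_left)).conj_eq
  have r₃ : g * X * g⁻¹ = X⁻¹ := by
    ext
    push_cast
    rw [hX, twistDiff, (hg0.sq_mul_inv_sq hg2).conj_eq]
    group
  have r₄ : X * (g * (h * X * h⁻¹) * g⁻¹) = h * X * h⁻¹ := by
    ext
    push_cast
    rw [hX, twistDiff, (hh0.sq_mul_inv_sq hh2).conj_eq, (hg0.sq_mul_inv_sq hg4).conj_eq]
    group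
  obtain ⟨w, hw⟩ : ∃ w, ψ X = SemidirectProduct.inl w := by
    refine ⟨(ψ X).left, SemidirectProduct.ext rfl ?_⟩
    rw [hψ, hX]
    simp [twistDiff, hμ, pow_two]
  have hconj : ∀ b, ψ (b * X * b⁻¹) =
      SemidirectProduct.inl (fun k => w ((ν (μ b))⁻¹ k)) := by
    intro b
    rw [map_mul, map_mul, map_inv, hw, DecoratedPerm.conj_inl, hψ]
  have ea₁ : ν (μ a₁) = outerSwap 0 * (outerSwap 2)⁻¹ := by simp [a₁, hνμ]
  have ea₂ : ν (μ a₂) = outerSwap 0 * (outerSwap 4)⁻¹ := by simp [a₂, hνμ]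
  have eg : ν (μ g) = outerSwap 1 * outerSwap 0 * outerSwap 2 * outerSwap 1 := by
    simp [g, hνμ, hsq]
  have eh : ν (μ h) = outerSwap 3 * outerSwap 2 * outerSwap 4 * outerSwap 3 := by
    simp [h, hνμ, hsq]
  have s₁ := congrArg ψ r₁
  have s₂ := congrArg ψ r₂
  have s₃ := congrArg ψ r₃
  have s₄ := congrArg ψ r₄
  rw [hconj, hw, ea₁] at s₁
  rw [hconj, hw, ea₂] at s₂
  rw [hconj, map_inv, hw, eg, ← map_inv] at s₃
  rw [map_mul, map_mul ψ (g * _), map_mul ψ g, map_inv, hconj, DecoratedPerm.conj_inl, hψ, hw, eg,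
    eh, ← map_mul SemidirectProduct.inl] at s₄
  have hinj := SemidirectProduct.inl_injective (φ := mulAutArrow (G := Equiv.Perm (Fin 6))
    (A := Fin 6) (M := Multiplicative ℤ))
  rw [hw, eq_one_of_outerSwap_symm w (congrFun (hinj s₁)) (congrFun (hinj s₂))
    (congrFun (hinj s₃)) (congrFun (hinj s₄)), map_one]

/-- A homomorphism on the commutator subgroup killing `σ₁² σ₃⁻²` kills its normal
closure in `B₆`. -/
lemma map_eq_one_of_mem_normalClosure {Q : Type*} [Group Q]
    (ψ : commutator (BraidGroup 6) →* Q) (X : commutator (BraidGroup 6))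
    (hX : (X : BraidGroup 6) = twistDiff) (hψ : ψ X = 1) (y : commutator (BraidGroup 6))
    (hy : (y : BraidGroup 6) ∈ Subgroup.normalClosure {twistDiff}) : ψ y = 1 := by
  have hle : Subgroup.normalClosure {twistDiff} ≤
      ψ.ker.map (commutator (BraidGroup 6)).subtype := by
    rw [Subgroup.normalClosure, Subgroup.closure_le]
    intro z hz
    obtain ⟨_, rfl, hz⟩ := Group.mem_conjugatesOfSet_iff.1 hz
    obtain ⟨b, rfl⟩ := isConj_iff.1 hz
    obtain ⟨e, he⟩ := exists_mul_zpow_mem_commutator b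
    refine ⟨⟨_, he⟩ * X * ⟨_, he⟩⁻¹, ?_, ?_⟩
    · simp [MonoidHom.mem_ker, hψ]
    · have hcomm : (σ 0 ^ e)⁻¹ * twistDiff * ((σ 0 ^ e)⁻¹)⁻¹ = twistDiff :=
        SemiconjBy.conj_eq (commute_twistDiff.zpow_left e).inv_left
      simp only [Subgroup.subtype_apply, Subgroup.coe_mul, Subgroup.coe_inv, hX]
      calc _ = b * ((σ 0 ^ e)⁻¹ * twistDiff * ((σ 0 ^ e)⁻¹)⁻¹) * b⁻¹ := by group
        _ = _ := by rw [hcomm]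
  obtain ⟨y', hy', h⟩ := hle hy
  rwa [← Subtype.ext h]

end SixStrands

/-- Let `ν` be an automorphism of `S_6` with `ν((1 2)) = (1 2)(3 4)(5 6)` and
`ν((1 2 3 4 5 6)) = (1 2 3)(4 5)` (written 0-based: `ν(swap 0 1) = (0 1)(2 3)(4 5)`
and `ν` of the 6-cycle `i ↦ i+1` is `(0 1 2)(3 4)`). Then there is no automorphism
`φ` of `B'_6` with `μ' ∘ φ = ν ∘ μ'`. -/
theorem no_exotic_aut_B6' (μ : BraidGroup 6 →* Equiv.Perm (Fin 6))
    (hμ : ∀ i : Fin (6 - 1), μ (σ i) =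
      Equiv.swap ⟨(i : ℕ), by have := i.isLt; omega⟩ ⟨(i : ℕ) + 1, by have := i.isLt; omega⟩)
    (ν : MulAut (Equiv.Perm (Fin 6)))
    (hν1 : ν (Equiv.swap 0 1) = Equiv.swap 0 1 * Equiv.swap 2 3 * Equiv.swap 4 5)
    (hν2 : ν (finRotate 6) = Equiv.swap 0 2 * Equiv.swap 0 1 * Equiv.swap 3 4) :
    ¬ ∃ φ : MulAut ↥(commutator (BraidGroup 6)),
        ∀ x : ↥(commutator (BraidGroup 6)), μ ↑(φ x) = ν (μ ↑x) := by
  rintro ⟨φ, hφ⟩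
  have hμ' : ∀ i : Fin (6 - 1), μ (σ i) = Equiv.swap i.castSucc i.succ := hμ
  let X : commutator (BraidGroup 6) := ⟨twistDiff, by
    rw [mem_commutator_iff]
    simp [twistDiff, braidExponent]⟩
  let ψ := (crossingHom.comp (commutator (BraidGroup 6)).subtype).comp φ.toMonoidHom
  have hψX : ψ X = 1 := map_twistDiff_eq_one μ hμ' ν (map_swap_eq_outerSwap ν hν1 hν2) ψ
    (fun g => (crossingHom_right μ hμ' _).trans (hφ g)) X rfl
  have hφy : φ (φ.symm X) = X := φ.apply_symm_apply X
  have hμX : μ X = 1 := by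
    simp [X, twistDiff, hμ', pow_two]
  have hμy : μ (φ.symm X) = 1 := by
    rw [← map_eq_one_iff ν ν.injective, ← hφ, hφy, hμX]
  refine crossingHom_twistDiff_ne_one ?_
  have := map_eq_one_of_mem_normalClosure ψ X rfl hψX (φ.symm X)
    (mem_normalClosure_twistDiff μ hμ' (φ.symm X).2 hμy)
  change crossingHom (φ (φ.symm X)) = 1 at this
  rwa [hφy] at this
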